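/- (Stationarity, third form, over limit models.) Let M ⊆ N ⊆ X and let 𝓜 = (M_i)_{i<σ} be a resolution of M such that for every i < σ there exist j with i < j < σ and f ∈ G_{M_i} with f • N ⊆ M_j (the group-theoretic rendering of 'M is a limit model, witnessed by 𝓜, with each successor stage universal over the previous one'). Suppose every orbit of G_N is closed in X (the Continuity of Types Property over N). If a ⌣[𝓜; M] N, b ⌣[𝓜; M] N and G_M • a = G_M • b (a and b have the same Galois type over M), then G_N • a = G_N • b (a and b have the same Galois type over N). -/

import Mathlib

open Set Metric

/-- Pointwise stabilizer of a set `A` inside the group `G`. -/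
def stabSet (G : Type*) [Group G] {X : Type*} [MulAction G X] (A : Set X) : Set G :=
  {g | ∀ x ∈ A, g • x = x}

/-- Galois type of `a` over `A`: the orbit of `a` under the pointwise stabilizer `G_A`. -/
def gtp (G : Type*) [Group G] {X : Type*} [MulAction G X] (A : Set X) (a : X) : Set X :=
  {x | ∃ g ∈ stabSet G A, g • a = x}

/-- Distance between the Galois types of `a` and `b` over `A`. -/
noncomputable def Dtp (G : Type*) [Group G] {X : Type*} [MulAction G X] [MetricSpace X]
    (A : Set X) (a b : X) : ℝ :=
  sInf {r : ℝ | ∃ x ∈ gtp G A a, ∃ y ∈ gtp G A b, r = dist x y}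

/-- `tp(a/M)` ε-splits over `N`. -/
def EpsSplits (G : Type*) [Group G] {X : Type*} [MulAction G X] [MetricSpace X]
    (ε : ℝ) (N M : Set X) (a : X) : Prop :=
  ∃ N₁ N₂ : Set X, N ⊆ N₁ ∧ N₁ ⊆ M ∧ N ⊆ N₂ ∧ N₂ ⊆ M ∧
    ∃ g ∈ stabSet G N, (fun x => g • x) '' N₁ = N₂ ∧ ε ≤ Dtp G N₂ (g • a) a

/-- `(F i)_{i<σ}` is a resolution of `N`. -/
def IsResolution {X : Type*} [MetricSpace X] (σ : Ordinal) (F : Ordinal → Set X)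
    (N : Set X) : Prop :=
  (∀ i j : Ordinal, i ≤ j → j < σ → F i ⊆ F j) ∧ (∀ i : Ordinal, i < σ → F i ⊆ N) ∧
    N = closure (⋃ i ∈ {i : Ordinal | i < σ}, F i)

/-- Smooth independence of `a` from `M` over the resolution `(F i)_{i<σ}` of the base. -/
def SmoothIndep (G : Type*) [Group G] {X : Type*} [MulAction G X] [MetricSpace X]
    (σ : Ordinal) (F : Ordinal → Set X) (M : Set X) (a : X) : Prop :=
  ∀ ε : ℝ, 0 < ε → ∃ i : Ordinal, i < σ ∧ ¬ EpsSplits G ε (F i) M a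

theorem stab_mul {G X : Type*} [Group G] [MulAction G X] {A : Set X} {g h : G}
    (hg : g ∈ stabSet G A) (hh : h ∈ stabSet G A) : g * h ∈ stabSet G A := by
  intro x hx
  rw [mul_smul, hh x hx, hg x hx]

theorem stab_inv {G X : Type*} [Group G] [MulAction G X] {A : Set X} {g : G}
    (hg : g ∈ stabSet G A) : g⁻¹ ∈ stabSet G A := by
  intro x hx
  rw [inv_smul_eq_iff, hg x hx]

theorem stab_one {G X : Type*} [Group G] [MulAction G X] {A : Set X} :
    (1 : G) ∈ stabSet G A := fun x _ => one_smul G x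

theorem nonsplit_close {G X : Type*} [Group G] [MetricSpace X] [MulAction G X]
    (hiso : ∀ (g : G) (x y : X), dist (g • x) (g • y) = dist x y)
    {ε : ℝ} {B N : Set X} {a : X} (h : ¬ EpsSplits G ε B N a) {f : G}
    (hf : f ∈ stabSet G B) (hBN : B ⊆ N) (hfN : (fun x => f • x) '' N ⊆ N) :
    ∃ p ∈ stabSet G ((fun x => f • x) '' N), dist (p • f • a) a < ε := by
  have hlt : Dtp G ((fun x => f • x) '' N) (f • a) a < ε := by
    by_contra hc
    exact h ⟨N, (fun x => f • x) '' N, hBN, subset_rfl, fun x hx => ⟨x, hBN hx, hf x hx⟩, hfN, f, hf, rfl,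
      not_lt.mp hc⟩
  have hne : {r : ℝ | ∃ x ∈ gtp G ((fun x => f • x) '' N) (f • a),
      ∃ y ∈ gtp G ((fun x => f • x) '' N) a, r = dist x y}.Nonempty :=
    ⟨_, f • a, ⟨1, stab_one, one_smul _ _⟩, a, ⟨1, stab_one, one_smul _ _⟩, rfl⟩
  obtain ⟨r, ⟨x, ⟨p, hp, rfl⟩, y, ⟨q, hq, rfl⟩, rfl⟩, hr⟩ := exists_lt_of_csInf_lt hne hlt
  refine ⟨q⁻¹ * p, stab_mul (stab_inv hq) hp, ?_⟩
  rw [← hiso q, mul_smul, smul_inv_smul]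
  exact hr

/-- Stationarity, third form, over limit models. -/
theorem stationarity_over_limit_models {G X : Type*} [Group G] [MetricSpace X] [MulAction G X]
    (hiso : ∀ (g : G) (x y : X), dist (g • x) (g • y) = dist x y)
    (M N : Set X) (hMN : M ⊆ N)
    (σ : Ordinal) (F : Ordinal → Set X) (hres : IsResolution σ F M)
    (hlim : ∀ i : Ordinal, i < σ → ∃ j : Ordinal, i < j ∧ j < σ ∧
      ∃ f ∈ stabSet G (F i), (fun x => f • x) '' N ⊆ F j)
    (hctp : ∀ x : X, IsClosed (gtp G N x))
    (a b : X) (ha : SmoothIndep G σ F N a) (hb : SmoothIndep G σ F N b)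
    (htp : gtp G M a = gtp G M b) :
    gtp G N a = gtp G N b := by
  obtain ⟨hmono, hsub, -⟩ := hres
  obtain ⟨h, hh, rfl⟩ : b ∈ gtp G M a := htp ▸ ⟨1, stab_one, one_smul _ _⟩
  have key : h • a ∈ gtp G N a := by
    rw [← (hctp a).closure_eq, Metric.mem_closure_iff]
    intro ε hε
    obtain ⟨i, hi, hsa⟩ := ha (ε / 2) (half_pos hε)
    obtain ⟨i', hi', hsb⟩ := hb (ε / 2) (half_pos hε)
    have hk : max i i' < σ := max_lt hi hi'
    obtain ⟨j, -, hj, f, hf, hfN⟩ := hlim _ hk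
    have hfM := hfN.trans (hsub j hj)
    obtain ⟨p, hp, hpa⟩ := nonsplit_close hiso hsa
      (fun x hx => hf x (hmono _ _ (le_max_left _ _) hk hx)) ((hsub i hi).trans hMN)
      (hfM.trans hMN)
    obtain ⟨q, hq, hqb⟩ := nonsplit_close hiso hsb
      (fun x hx => hf x (hmono _ _ (le_max_right _ _) hk hx)) ((hsub i' hi').trans hMN)
      (hfM.trans hMN)
    have hw : q⁻¹ * (h * p) ∈ stabSet G ((fun x => f • x) '' N) :=
      stab_mul (stab_inv hq) (stab_mul (fun x hx => hh x (hfM hx)) hp)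
    refine ⟨(f⁻¹ * (q⁻¹ * (h * p)) * f) • a, ⟨_, ?_, rfl⟩, ?_⟩
    · intro x hx
      rw [mul_smul, mul_smul, hw _ ⟨x, hx, rfl⟩, inv_smul_smul]
    · rw [← hiso f, ← hiso q]
      simp only [mul_smul, smul_inv_smul]
      rw [← hiso h] at hpa
      have := dist_triangle_right (q • f • h • a) (h • p • f • a) (h • a)
      linarith
  obtain ⟨g, hg, hga⟩ := key
  rw [← hga]
  ext x
  constructor
  · rintro ⟨u, hu, rfl⟩
    exact ⟨u * g⁻¹, stab_mul hu (stab_inv hg), by rw [mul_smul, inv_smul_smul]⟩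
  · rintro ⟨u, hu, rfl⟩
    exact ⟨u * g, stab_mul hu hg, mul_smul _ _ _⟩
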